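/- arXiv:quant-ph/0009091 — 2 statements merged into one kernel-verified Lean document; each statement's English description precedes it below -/
import Mathlib

section
/- The infinite Hilbert matrix A with entries a_{k,l} = 1/(k+l−1), for k,l ≥ 1, defines a bounded operator on ℓ²(ℕ) with operator norm exactly π. -/
open Finset Filter

/-- For `b > 0`, a primitive on `(0, ∞)` of `y ↦ 1 / ((b ^ 2 + y) * √y)`. -/
noncomputable def hilbertPrimitive (b y : ℝ) : ℝ := 2 / b * Real.arctan (√y / b)

lemma hasDerivAt_hilbertPrimitive {b y : ℝ} (hb : 0 < b) (hy : 0 < y) :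
    HasDerivAt (hilbertPrimitive b) (1 / ((b ^ 2 + y) * √y)) y := by
  have h := (((Real.hasDerivAt_sqrt hy.ne').div_const b).arctan).const_mul (2 / b)
  refine h.congr_deriv ?_
  have hs : 0 < √y := Real.sqrt_pos.2 hy
  rw [div_pow, Real.sq_sqrt hy.le]
  field_simp

lemma continuous_hilbertPrimitive (b : ℝ) : Continuous (hilbertPrimitive b) := by
  unfold hilbertPrimitive
  fun_prop

lemma hilbertPrimitive_zero (b : ℝ) : hilbertPrimitive b 0 = 0 := by
  simp [hilbertPrimitive]

lemma hilbertPrimitive_le {b : ℝ} (hb : 0 < b) (y : ℝ) : hilbertPrimitive b y ≤ Real.pi / b := by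
  calc hilbertPrimitive b y ≤ 2 / b * (Real.pi / 2) := by
        unfold hilbertPrimitive
        gcongr
        exact (Real.arctan_lt_pi_div_two _).le
    _ = Real.pi / b := by ring

/-- The tangent line at `t ^ 2` of the convex function `y ↦ 1 / ((a + y) * √y)` lies below it;
the variable is `y = s ^ 2`. -/
lemma tangent_le_one_div_add_mul_sqrt {a s t : ℝ} (ha : 0 < a) (hs : 0 < s) (ht : 0 < t) :
    1 / ((a + t ^ 2) * t) - (a + 3 * t ^ 2) / (2 * t ^ 3 * (a + t ^ 2) ^ 2) * (s ^ 2 - t ^ 2) ≤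
      1 / ((a + s ^ 2) * s) := by
  have key : 1 / ((a + s ^ 2) * s) - (1 / ((a + t ^ 2) * t)
      - (a + 3 * t ^ 2) / (2 * t ^ 3 * (a + t ^ 2) ^ 2) * (s ^ 2 - t ^ 2)) =
      (s - t) ^ 2 * (a ^ 2 * (s + 2 * t) + a * (s ^ 3 + 2 * s ^ 2 * t + 3 * s * t ^ 2 + 4 * t ^ 3)
        + t ^ 2 * (3 * s ^ 3 + 6 * s ^ 2 * t + 4 * s * t ^ 2 + 2 * t ^ 3)) /
      (2 * t ^ 3 * (a + t ^ 2) ^ 2 * ((a + s ^ 2) * s)) := by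
    field_simp
    ring
  rw [← sub_nonneg, key]
  positivity

/-- The midpoint rule underestimates the integral of `y ↦ 1 / ((b ^ 2 + y) * √y)`. -/
lemma midpoint_le_hilbertPrimitive_sub {b m : ℝ} (hb : 0 < b) (hm : 1 / 2 ≤ m) :
    1 / ((b ^ 2 + m) * √m) ≤ hilbertPrimitive b (m + 1 / 2) - hilbertPrimitive b (m - 1 / 2) := by
  have hm0 : 0 < m := by linarith
  set d : ℝ := (b ^ 2 + 3 * m) / (2 * √m ^ 3 * (b ^ 2 + m) ^ 2)
  set φ : ℝ := 1 / ((b ^ 2 + m) * √m)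
  let M : ℝ → ℝ := fun y => hilbertPrimitive b y - φ * (y - m) + d * (y - m) ^ 2 / 2
  have hder : ∀ y, 0 < y → HasDerivAt M (1 / ((b ^ 2 + y) * √y) - φ + d * (y - m)) y := by
    intro y hy
    have h1 := (hasDerivAt_id y).sub_const m
    have h2 := ((hasDerivAt_hilbertPrimitive hb hy).sub (h1.const_mul φ)).add
      (((h1.pow 2).const_mul d).div_const 2)
    refine h2.congr_deriv ?_
    simp
    ring
  have hcont : Continuous M := by
    have := continuous_hilbertPrimitive b
    fun_prop
  have hmono : MonotoneOn M (Set.Ici 0) := by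
    refine monotoneOn_of_deriv_nonneg (convex_Ici 0) hcont.continuousOn ?_ ?_
    · intro y hy
      rw [interior_Ici] at hy
      exact (hder y hy).differentiableAt.differentiableWithinAt
    · intro y hy
      rw [interior_Ici] at hy
      rw [(hder y hy).deriv]
      have h := tangent_le_one_div_add_mul_sqrt (pow_pos hb 2) (Real.sqrt_pos.2 hy)
        (Real.sqrt_pos.2 hm0)
      rw [Real.sq_sqrt hm0.le, Real.sq_sqrt (le_of_lt hy)] at h
      linarith
  have h := hmono (a := m - 1 / 2) (b := m + 1 / 2) (by simp; linarith) (by simp; linarith)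
    (by linarith)
  simp only [M] at h
  linarith

/-- The integral of the decreasing function `z ↦ 1 / ((b ^ 2 + z) * √z)` over `[y, y + 1]` is at
most its value at the left end point. -/
lemma hilbertPrimitive_sub_le {b y : ℝ} (hb : 0 < b) (hy : 0 < y) :
    hilbertPrimitive b (y + 1) - hilbertPrimitive b y ≤ 1 / ((b ^ 2 + y) * √y) := by
  obtain ⟨c, hc, h⟩ := exists_hasDerivAt_eq_slope (hilbertPrimitive b)
    (fun z => 1 / ((b ^ 2 + z) * √z)) (lt_add_one y) (continuous_hilbertPrimitive b).continuousOn
    (fun z hz => hasDerivAt_hilbertPrimitive hb (hy.trans hz.1))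
  rw [add_sub_cancel_left, div_one] at h
  rw [← h]
  have := Real.sqrt_pos.2 hy
  have hyc := hc.1.le
  have := hy.trans hc.1
  gcongr

/-- The Schur test inequality for the Hilbert matrix with weights `1 / √(l + 1 / 2)`. -/
lemma sum_hilbert_weight_le (k : ℕ) (s : Finset ℕ) :
    ∑ l ∈ s, 1 / ((k : ℝ) + l + 1) * (1 / √((l : ℝ) + 1 / 2)) ≤
      Real.pi * (1 / √((k : ℝ) + 1 / 2)) := by
  have hk : (0 : ℝ) < (k : ℝ) + 1 / 2 := by positivity
  have hb := Real.sqrt_pos.2 hk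
  obtain ⟨n, hn⟩ := s.exists_nat_subset_range
  calc _ ≤ ∑ l ∈ range n, 1 / ((k : ℝ) + l + 1) * (1 / √((l : ℝ) + 1 / 2)) :=
        sum_le_sum_of_subset_of_nonneg hn fun _ _ _ => by positivity
    _ ≤ ∑ l ∈ range n, (hilbertPrimitive √((k : ℝ) + 1 / 2) ((l + 1 : ℕ) : ℝ) -
          hilbertPrimitive √((k : ℝ) + 1 / 2) (l : ℝ)) := by
        refine sum_le_sum fun l _ => ?_
        have h := midpoint_le_hilbertPrimitive_sub hb (m := (l : ℝ) + 1 / 2)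
          (by linarith [(Nat.cast_nonneg l : (0 : ℝ) ≤ l)])
        rw [Real.sq_sqrt hk.le] at h
        rw [add_sub_cancel_right, add_add_add_comm, add_assoc (l : ℝ), add_halves] at h
        rw [one_div_mul_one_div]
        exact_mod_cast h
    _ ≤ Real.pi * (1 / √((k : ℝ) + 1 / 2)) := by
        rw [sum_range_sub (fun l : ℕ => hilbertPrimitive √((k : ℝ) + 1 / 2) (l : ℝ))]
        simpa [hilbertPrimitive_zero, div_eq_mul_inv] using hilbertPrimitive_le hb n

/-- Hilbert's inequality for finite sections of the Hilbert matrix. -/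
lemma sum_sq_hilbert_le (x : ℕ → ℝ) (s t : Finset ℕ) :
    ∑ k ∈ s, (∑ l ∈ t, x l / ((k : ℝ) + l + 1)) ^ 2 ≤ Real.pi ^ 2 * ∑ l ∈ t, x l ^ 2 := by
  have hw (l : ℕ) : 0 < √((l : ℝ) + 1 / 2) := Real.sqrt_pos.2 (by positivity)
  calc _ ≤ ∑ k ∈ s, (Real.pi * (1 / √((k : ℝ) + 1 / 2))) *
          ∑ l ∈ t, x l ^ 2 * √((l : ℝ) + 1 / 2) / ((k : ℝ) + l + 1) := by
        refine sum_le_sum fun k _ => ?_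
        refine (sum_sq_le_sum_mul_sum_of_sq_le_mul t
          (f := fun l : ℕ => 1 / ((k : ℝ) + l + 1) * (1 / √((l : ℝ) + 1 / 2)))
          (g := fun l : ℕ => x l ^ 2 * √((l : ℝ) + 1 / 2) / ((k : ℝ) + l + 1))
          (fun l _ => by positivity) (fun l _ => by positivity) fun l _ => ?_).trans ?_
        · have := hw l
          refine le_of_eq ?_
          field_simp
        · refine mul_le_mul_of_nonneg_right (sum_hilbert_weight_le k t) ?_
          exact sum_nonneg fun l _ => by positivity
    _ = ∑ l ∈ t, Real.pi * (x l ^ 2 * √((l : ℝ) + 1 / 2)) *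
          ∑ k ∈ s, 1 / ((l : ℝ) + k + 1) * (1 / √((k : ℝ) + 1 / 2)) := by
        simp_rw [mul_sum]
        rw [sum_comm]
        refine sum_congr rfl fun l _ => sum_congr rfl fun k _ => ?_
        rw [add_comm (l : ℝ) k]
        ring
    _ ≤ ∑ l ∈ t, Real.pi * (x l ^ 2 * √((l : ℝ) + 1 / 2)) *
          (Real.pi * (1 / √((l : ℝ) + 1 / 2))) := by
        refine sum_le_sum fun l _ => ?_
        exact mul_le_mul_of_nonneg_left (sum_hilbert_weight_le l s) (by positivity)
    _ = Real.pi ^ 2 * ∑ l ∈ t, x l ^ 2 := by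
        rw [mul_sum]
        refine sum_congr rfl fun l _ => ?_
        have := hw l
        field_simp

lemma sum_sq_le_norm_sq (x : lp (fun _ : ℕ => ℝ) 2) (s : Finset ℕ) :
    ∑ l ∈ s, x l ^ 2 ≤ ‖x‖ ^ 2 := by
  simpa using lp.sum_rpow_le_norm_rpow (p := 2) (by norm_num) x s

lemma summable_hilbert_row (x : lp (fun _ : ℕ => ℝ) 2) (k : ℕ) :
    Summable fun l : ℕ => x l / ((k : ℝ) + l + 1) := by
  refine Summable.of_norm (summable_of_sum_le (c := Real.pi * ‖x‖) (fun _ => norm_nonneg _) ?_)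
  intro t
  have h := sum_sq_hilbert_le (fun l => |x l|) {k} t
  simp only [sum_singleton, sq_abs] at h
  have hnorm : ∀ l : ℕ, ‖x l / ((k : ℝ) + l + 1)‖ = |x l| / ((k : ℝ) + l + 1) := fun l => by
    rw [norm_div, Real.norm_eq_abs, Real.norm_of_nonneg (by positivity)]
  simp_rw [hnorm]
  refine le_of_sq_le_sq ?_ (by positivity)
  rw [mul_pow]
  exact h.trans (mul_le_mul_of_nonneg_left (sum_sq_le_norm_sq x t) (by positivity))

lemma sum_sq_tsum_hilbert_le (x : lp (fun _ : ℕ => ℝ) 2) (s : Finset ℕ) :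
    ∑ k ∈ s, (∑' l : ℕ, x l / ((k : ℝ) + l + 1)) ^ 2 ≤ (Real.pi * ‖x‖) ^ 2 := by
  refine le_of_tendsto (tendsto_finsetSum s fun k _ => (summable_hilbert_row x k).hasSum.pow 2)
    (Eventually.of_forall fun t => ?_)
  rw [mul_pow]
  exact (sum_sq_hilbert_le x s t).trans
    (mul_le_mul_of_nonneg_left (sum_sq_le_norm_sq x t) (by positivity))

/-- The operator of the Hilbert matrix on `ℓ²`, without its norm bound. -/
noncomputable def hilbertLinearMap : lp (fun _ : ℕ => ℝ) 2 →ₗ[ℝ] lp (fun _ : ℕ => ℝ) 2 where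
  toFun x := ⟨fun k : ℕ => ∑' l : ℕ, x l / ((k : ℝ) + l + 1),
    memℓp_gen' (C := (Real.pi * ‖x‖) ^ 2) fun s => by simpa using sum_sq_tsum_hilbert_le x s⟩
  map_add' x y := by
    ext k
    simp only [lp.coeFn_add, Pi.add_apply, add_div]
    exact (summable_hilbert_row x k).tsum_add (summable_hilbert_row y k)
  map_smul' c x := by
    ext k
    simp only [lp.coeFn_smul, Pi.smul_apply, smul_eq_mul, mul_div_assoc, RingHom.id_apply]
    exact tsum_mul_left

lemma norm_hilbertLinearMap_le (x : lp (fun _ : ℕ => ℝ) 2) :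
    ‖hilbertLinearMap x‖ ≤ Real.pi * ‖x‖ := by
  refine lp.norm_le_of_forall_sum_le (by norm_num) (by positivity) fun s => ?_
  simpa [hilbertLinearMap] using sum_sq_tsum_hilbert_le x s

lemma arctan_le_self_of_nonneg {x : ℝ} (hx : 0 ≤ x) : Real.arctan x ≤ x := by
  simpa using Real.le_tan (Real.arctan_nonneg.2 hx) (Real.arctan_lt_pi_div_two x)

lemma le_hilbertPrimitive_sub {b c : ℝ} (hb : 0 < b) (hc : 0 < c) :
    1 / b * (Real.pi - 2 * (b / c) - 2 * (1 / b)) ≤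
      hilbertPrimitive b (c ^ 2) - hilbertPrimitive b 1 := by
  have h1 := arctan_le_self_of_nonneg (x := b / c) (by positivity)
  have h2 := arctan_le_self_of_nonneg (x := 1 / b) (by positivity)
  have h3 := Real.arctan_inv_of_pos (x := b / c) (by positivity)
  rw [inv_div] at h3
  unfold hilbertPrimitive
  rw [Real.sqrt_sq hc.le, Real.sqrt_one, h3]
  calc _ = 2 / b * (Real.pi / 2 - b / c - 1 / b) := by ring
    _ ≤ 2 / b * (Real.pi / 2 - Real.arctan (b / c) - Real.arctan (1 / b)) := by gcongr
    _ = _ := by ring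

/-- Lower bound for the rows of the `n`-th section of the Hilbert matrix applied to the vector
`1 / √(l + 1)`. -/
lemma le_sum_hilbert_row (n k : ℕ) :
    1 / √((k : ℝ) + 1) * (Real.pi - 2 * (√((k : ℝ) + 1) / √((n : ℝ) + 1)) -
        2 * (1 / √((k : ℝ) + 1))) ≤
      ∑ l ∈ range n, 1 / √((l : ℝ) + 1) / ((k : ℝ) + l + 1) := by
  have hk : (0 : ℝ) < (k : ℝ) + 1 := by positivity
  have hn : (0 : ℝ) < (n : ℝ) + 1 := by positivity
  have hb := Real.sqrt_pos.2 hk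
  refine (le_hilbertPrimitive_sub hb (Real.sqrt_pos.2 hn)).trans ?_
  have hsum := sum_range_sub (fun l : ℕ => hilbertPrimitive √((k : ℝ) + 1) ((l : ℝ) + 1)) n
  simp only [Nat.cast_zero, zero_add] at hsum
  rw [Real.sq_sqrt hn.le, ← hsum]
  refine sum_le_sum fun l _ => ?_
  have hl : (0 : ℝ) < (l : ℝ) + 1 := by positivity
  have := Real.sqrt_pos.2 hl
  push_cast
  refine (hilbertPrimitive_sub_le hb hl).trans ?_
  rw [Real.sq_sqrt hk.le, div_div, mul_comm √((l : ℝ) + 1)]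
  gcongr 1 / (?_ * _)
  linarith

lemma sum_one_div_sqrt_le (n : ℕ) : ∑ k ∈ range n, 1 / √((k : ℝ) + 1) ≤ 2 * √(n : ℝ) := by
  induction n with
  | zero => simp
  | succ n ih =>
    rw [sum_range_succ]
    push_cast
    have hc : 0 < √((n : ℝ) + 1) := Real.sqrt_pos.2 (by positivity)
    have h1 := Real.sq_sqrt (show (0 : ℝ) ≤ (n : ℝ) + 1 by positivity)
    have h2 := Real.sq_sqrt (show (0 : ℝ) ≤ (n : ℝ) by positivity)
    have : 1 / √((n : ℝ) + 1) ≤ 2 * √((n : ℝ) + 1) - 2 * √(n : ℝ) := by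
      rw [div_le_iff₀ hc]
      nlinarith [sq_nonneg (√((n : ℝ) + 1) - √(n : ℝ))]
    linarith

lemma sum_one_div_mul_sqrt_le (n : ℕ) :
    ∑ k ∈ range n, 1 / (((k : ℝ) + 1) * √((k : ℝ) + 1)) ≤ 4 - 4 / √((n : ℝ) + 1) := by
  induction n with
  | zero => simp
  | succ n ih =>
    rw [sum_range_succ]
    push_cast
    have h1 := Real.sq_sqrt (show (0 : ℝ) ≤ (n : ℝ) + 1 by positivity)
    have h2 := Real.sq_sqrt (show (0 : ℝ) ≤ (n : ℝ) + 1 + 1 by positivity)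
    have hc : 0 < √((n : ℝ) + 1) := Real.sqrt_pos.2 (by positivity)
    have hd : 0 < √((n : ℝ) + 1 + 1) := Real.sqrt_pos.2 (by positivity)
    set c := √((n : ℝ) + 1)
    set d := √((n : ℝ) + 1 + 1)
    have hn : (0 : ℝ) ≤ n := n.cast_nonneg
    have hdc : d ≤ 2 * c := by
      refine le_of_sq_le_sq ?_ (by positivity)
      nlinarith
    have key : 1 / (((n : ℝ) + 1) * c) ≤ 4 / c - 4 / d := by
      have h3 : (d - c) * (d + c) = 1 := by linarith
      have h4 : 4 / c - 4 / d = 4 / (c * d * (d + c)) := by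
        field_simp
        linarith
      rw [h4, ← h1, div_le_div_iff₀ (by positivity) (by positivity)]
      have : d * (d + c) ≤ 4 * c ^ 2 := by nlinarith
      nlinarith
    linarith

lemma le_sum_sum_hilbert (n : ℕ) :
    Real.pi * ∑ k ∈ range n, 1 / ((k : ℝ) + 1) - 12 ≤
      ∑ k ∈ range n, 1 / √((k : ℝ) + 1) *
        ∑ l ∈ range n, 1 / √((l : ℝ) + 1) / ((k : ℝ) + l + 1) := by
  have hn : 0 < √((n : ℝ) + 1) := Real.sqrt_pos.2 (by positivity)
  have hsum : ∑ k ∈ range n, 1 / √((k : ℝ) + 1) * (1 / √((k : ℝ) + 1) *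
      (Real.pi - 2 * (√((k : ℝ) + 1) / √((n : ℝ) + 1)) - 2 * (1 / √((k : ℝ) + 1)))) =
      Real.pi * ∑ k ∈ range n, 1 / ((k : ℝ) + 1)
        - 2 / √((n : ℝ) + 1) * ∑ k ∈ range n, 1 / √((k : ℝ) + 1)
        - 2 * ∑ k ∈ range n, 1 / (((k : ℝ) + 1) * √((k : ℝ) + 1)) := by
    simp_rw [mul_sum, ← sum_sub_distrib]
    refine sum_congr rfl fun k _ => ?_
    have hk : (0 : ℝ) < (k : ℝ) + 1 := by positivity
    have hc := Real.sqrt_pos.2 hk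
    have h1 := Real.sq_sqrt hk.le
    set c := √((k : ℝ) + 1)
    rw [← h1]
    field_simp
  have h1 : 2 / √((n : ℝ) + 1) * ∑ k ∈ range n, 1 / √((k : ℝ) + 1) ≤ 4 := by
    rw [div_mul_eq_mul_div, div_le_iff₀ hn]
    have := sum_one_div_sqrt_le n
    have : √(n : ℝ) ≤ √((n : ℝ) + 1) := Real.sqrt_le_sqrt (by linarith)
    linarith
  have h2 := sum_one_div_mul_sqrt_le n
  have h3 : 0 ≤ 4 / √((n : ℝ) + 1) := by positivity
  calc _ ≤ ∑ k ∈ range n, 1 / √((k : ℝ) + 1) * (1 / √((k : ℝ) + 1) *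
      (Real.pi - 2 * (√((k : ℝ) + 1) / √((n : ℝ) + 1)) - 2 * (1 / √((k : ℝ) + 1)))) := by
        rw [hsum]
        linarith
    _ ≤ _ := sum_le_sum fun k _ =>
        mul_le_mul_of_nonneg_left (le_sum_hilbert_row n k) (by positivity)

lemma le_norm_mul_harmonic {A : lp (fun _ : ℕ => ℝ) 2 →L[ℝ] lp (fun _ : ℕ => ℝ) 2}
    (hA : ∀ (x : lp (fun _ : ℕ => ℝ) 2) (k : ℕ), A x k = ∑' l : ℕ, x l / ((k : ℝ) + l + 1))
    (n : ℕ) :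
    Real.pi * ∑ k ∈ range n, 1 / ((k : ℝ) + 1) - 12 ≤
      ‖A‖ * ∑ k ∈ range n, 1 / ((k : ℝ) + 1) := by
  let x : lp (fun _ : ℕ => ℝ) 2 := ∑ k ∈ range n, lp.single 2 k (1 / √((k : ℝ) + 1))
  have hx (l : ℕ) : x l = if l ∈ range n then 1 / √((l : ℝ) + 1) else 0 := by
    simp only [x, lp.coeFn_sum]
    rw [Finset.sum_apply]
    simp only [lp.single_apply, Pi.single_apply]
    rw [sum_ite_eq]
  have hnorm : ‖x‖ ^ 2 = ∑ k ∈ range n, 1 / ((k : ℝ) + 1) := by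
    have h := lp.norm_sum_single (p := 2) (E := fun _ : ℕ => ℝ) (by norm_num)
      (fun k : ℕ => 1 / √((k : ℝ) + 1)) (range n)
    simp only [ENNReal.toReal_ofNat, Real.rpow_ofNat, Real.norm_eq_abs, sq_abs] at h
    rw [h]
    refine sum_congr rfl fun k _ => ?_
    rw [div_pow, Real.sq_sqrt (by positivity), one_pow]
  have hinner : inner ℝ x (A x) = ∑ k ∈ range n, 1 / √((k : ℝ) + 1) *
      ∑ l ∈ range n, 1 / √((l : ℝ) + 1) / ((k : ℝ) + l + 1) := by
    rw [show inner ℝ x (A x) = ∑ k ∈ range n, inner ℝ (lp.single 2 k (1 / √((k : ℝ) + 1))) (A x)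
      from sum_inner _ _ _]
    refine sum_congr rfl fun k _ => ?_
    rw [lp.inner_single_left, hA, tsum_eq_sum (s := range n) fun l hl => by
      rw [hx, if_neg hl, zero_div]]
    rw [sum_congr rfl fun l hl => by rw [hx, if_pos hl]]
    simp [mul_comm]
  calc _ ≤ inner ℝ x (A x) := hinner ▸ le_sum_sum_hilbert n
    _ ≤ ‖x‖ * ‖A x‖ := real_inner_le_norm _ _
    _ ≤ ‖x‖ * (‖A‖ * ‖x‖) := by gcongr; exact A.le_opNorm x
    _ = ‖A‖ * ∑ k ∈ range n, 1 / ((k : ℝ) + 1) := by rw [← hnorm]; ring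

lemma pi_le_norm_of_hilbert {A : lp (fun _ : ℕ => ℝ) 2 →L[ℝ] lp (fun _ : ℕ => ℝ) 2}
    (hA : ∀ (x : lp (fun _ : ℕ => ℝ) 2) (k : ℕ), A x k = ∑' l : ℕ, x l / ((k : ℝ) + l + 1)) :
    Real.pi ≤ ‖A‖ := by
  by_contra! hlt
  have hpos : 0 < Real.pi - ‖A‖ := sub_pos.2 hlt
  obtain ⟨n, hn⟩ := (Real.tendsto_sum_range_one_div_nat_succ_atTop.eventually_gt_atTop
    (12 / (Real.pi - ‖A‖))).exists
  rw [div_lt_iff₀ hpos] at hn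
  linarith [le_norm_mul_harmonic hA n]

/-- The infinite Hilbert matrix `a_{k,l} = 1/(k+l-1)` (here `0`-indexed:
`a_{k,l} = 1/(k+l+1)`) defines a bounded operator on `ℓ²(ℕ)` of norm exactly `π`. -/
theorem hilbert_matrix_bounded_norm_pi :
    ∃ A : lp (fun _ : ℕ => ℝ) 2 →L[ℝ] lp (fun _ : ℕ => ℝ) 2,
      (∀ (x : lp (fun _ : ℕ => ℝ) 2) (k : ℕ),
        (A x : ℕ → ℝ) k = ∑' l : ℕ, (x : ℕ → ℝ) l / ((k : ℝ) + l + 1)) ∧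
      ‖A‖ = Real.pi :=
  ⟨hilbertLinearMap.mkContinuous Real.pi norm_hilbertLinearMap_le, fun _ _ => rfl,
    le_antisymm (LinearMap.mkContinuous_norm_le _ Real.pi_pos.le _)
      (pi_le_norm_of_hilbert fun _ _ => rfl)⟩
end

section
/- Let σ be a permutation of {0,...,n−1}, and for 0 ≤ k ≤ n−2, 1 ≤ d ≤ n−k−1 define τ = σ^{(k,d)} = (k+d, k+d−1, ..., k) ∘ σ. Then the comparison matrices M_σ and M_τ, defined by (M_σ)_{i,j} = 1 iff σ(i) ≤ σ(j), differ exactly on the entries indexed by the unordered pairs {σ⁻¹(k), σ⁻¹(k+i)} for 1 ≤ i ≤ d (i.e., on exactly 2d entries). -/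
/-- The element of `Fin n` with value `m` (given via `m % n`; when `m < n` this is just `m`). -/
def mkFin (n m : ℕ) (h : 0 < n) : Fin n := ⟨m % n, Nat.mod_lt _ h⟩

/-- The comparison matrix of the permutation `σ`: `(M_σ)_{i,j} = 1` iff `σ(i) ≤ σ(j)`. -/
def cmpMatrix {n : ℕ} (σ : Equiv.Perm (Fin n)) : Matrix (Fin n) (Fin n) ℕ :=
  Matrix.of fun i j => if σ i ≤ σ j then 1 else 0

theorem eq_inv_mkFin_iff {n m : ℕ} (σ : Equiv.Perm (Fin n)) (hn : 0 < n) (hm : m < n)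
    (i : Fin n) : i = σ⁻¹ (mkFin n m hn) ↔ (σ i : ℕ) = m := by
  rw [Equiv.Perm.eq_inv_iff_eq, Fin.ext_iff]
  simp [mkFin, Nat.mod_eq_of_lt hm]

theorem cmpMatrix_ne_iff {n : ℕ} (σ τ : Equiv.Perm (Fin n)) (i j : Fin n) :
    cmpMatrix σ i j ≠ cmpMatrix τ i j ↔
      ¬((σ i : ℕ) ≤ (σ j : ℕ) ↔ (τ i : ℕ) ≤ (τ j : ℕ)) := by
  simp only [cmpMatrix, Matrix.of_apply, Fin.le_def]
  split_ifs <;> simp only [*, ne_eq, not_true_eq_false, one_ne_zero, zero_ne_one,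
    not_false_eq_true, iff_true, iff_false]

theorem comparison_matrices_differ (n : ℕ) (hn : 2 ≤ n)
    (σ τ : Equiv.Perm (Fin n)) (k d : ℕ)
    (hk : k ≤ n - 2) (hd1 : 1 ≤ d) (hd2 : d ≤ n - k - 1)
    (hτ : ∀ x : Fin n, (τ x : ℕ) =
      if (σ x : ℕ) = k then k + d
      else if k + 1 ≤ (σ x : ℕ) ∧ (σ x : ℕ) ≤ k + d then (σ x : ℕ) - 1
      else (σ x : ℕ)) :
    ∀ i j : Fin n,
      cmpMatrix σ i j ≠ cmpMatrix τ i j ↔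
        ∃ m, ∃ _h : 1 ≤ m ∧ m ≤ d,
          ({i, j} : Set (Fin n))
            = {σ⁻¹ (mkFin n k (by omega)), σ⁻¹ (mkFin n (k + m) (by omega))} := by
  intro i j
  rw [cmpMatrix_ne_iff]
  constructor
  · intro h
    have hi := hτ i
    have hj := hτ j
    have hcases : ((σ i : ℕ) = k ∧ k + 1 ≤ (σ j : ℕ) ∧ (σ j : ℕ) ≤ k + d) ∨
        ((σ j : ℕ) = k ∧ k + 1 ≤ (σ i : ℕ) ∧ (σ i : ℕ) ≤ k + d) := by
      have hinj : (σ i : ℕ) = σ j → (τ i : ℕ) = τ j := fun e => by rw [hi, hj, e]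
      split_ifs at hi hj <;> omega
    rcases hcases with ⟨h₁, h₂, h₃⟩ | ⟨h₁, h₂, h₃⟩
    · refine ⟨(σ j : ℕ) - k, ⟨by omega, by omega⟩, Set.pair_eq_pair_iff.2 (Or.inl ?_)⟩
      rw [eq_inv_mkFin_iff σ _ (by omega), eq_inv_mkFin_iff σ _ (by omega)]
      omega
    · refine ⟨(σ i : ℕ) - k, ⟨by omega, by omega⟩, Set.pair_eq_pair_iff.2 (Or.inr ?_)⟩
      rw [eq_inv_mkFin_iff σ _ (by omega), eq_inv_mkFin_iff σ _ (by omega)]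
      omega
  · rintro ⟨m, hm, h⟩
    rw [Set.pair_eq_pair_iff, eq_inv_mkFin_iff σ _ (by omega), eq_inv_mkFin_iff σ _ (by omega),
      eq_inv_mkFin_iff σ _ (by omega), eq_inv_mkFin_iff σ _ (by omega)] at h
    have hi := hτ i
    have hj := hτ j
    split_ifs at hi hj <;> omega
end
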